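/- Let π: C → D be a surjective homomorphism of coalgebras (Δ'∘π = (π⊗π)∘Δ and ε'∘π = ε). Then the induction functor ind_D^C carries injective D-comodules to injective C-comodules; in particular, any decomposition D ≅ ⊕_ν m_ν I_ν of D into indecomposable injective D-comodules yields a decomposition C ≅ ⊕_ν m_ν ind_D^C(I_ν) of C into injective C-comodules. -/

import Mathlib

open TensorProduct

namespace SuperCoalg

variable (k : Type) [Field k]
variable (C : Type) [AddCommGroup C] [Module k C] [Coalgebra k C]

/-- `β : V →ₗ[k] V ⊗[k] C` is a (right) comodule structure map over the coalgebra `C`. -/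
structure IsComodule {V : Type} [AddCommGroup V] [Module k V]
    (β : V →ₗ[k] V ⊗[k] C) : Prop where
  coassoc : (TensorProduct.assoc k V C C).toLinearMap ∘ₗ β.rTensor C ∘ₗ β
      = LinearMap.lTensor V (Coalgebra.comul (R := k) (A := C)) ∘ₗ β
  counit_id : (TensorProduct.rid k V).toLinearMap ∘ₗ
      LinearMap.lTensor V (Coalgebra.counit (R := k) (A := C)) ∘ₗ β = LinearMap.id

/-- A bundled right `C`-comodule. -/
structure Comod where
  V : Type
  [addCommGroup : AddCommGroup V]
  [module : Module k V]
  β : V →ₗ[k] V ⊗[k] C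
  isComodule : IsComodule k C β

attribute [instance] Comod.addCommGroup Comod.module

variable {k C}

/-- A submodule `W ≤ V` is a subcomodule for the structure map `β`. -/
def IsSubcomodule {V : Type} [AddCommGroup V] [Module k V]
    (β : V →ₗ[k] V ⊗[k] C) (W : Submodule k V) : Prop :=
  ∀ w ∈ W, β w ∈ LinearMap.range (W.subtype.rTensor C)

/-- `f` is a homomorphism of right `C`-comodules from `(V, β)` to `(W, γ)`. -/
def IsComodHom {V W : Type} [AddCommGroup V] [Module k V] [AddCommGroup W] [Module k W]
    (β : V →ₗ[k] V ⊗[k] C) (γ : W →ₗ[k] W ⊗[k] C) (f : V →ₗ[k] W) : Prop :=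
  f.rTensor C ∘ₗ β = γ ∘ₗ f

/-- A subcomodule is simple if it is nonzero and has no nonzero proper subcomodules. -/
def IsSimpleSubcomodule {V : Type} [AddCommGroup V] [Module k V]
    (β : V →ₗ[k] V ⊗[k] C) (W : Submodule k V) : Prop :=
  IsSubcomodule β W ∧ W ≠ ⊥ ∧
    ∀ U : Submodule k V, U ≤ W → IsSubcomodule β U → U = ⊥ ∨ U = W

/-- The socle of the comodule `(V, β)`: the sum of all its simple subcomodules. -/
def socle {V : Type} [AddCommGroup V] [Module k V]
    (β : V →ₗ[k] V ⊗[k] C) : Submodule k V :=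
  sSup {W : Submodule k V | IsSimpleSubcomodule β W}

/-- A comodule is simple if it is nonzero and has no nonzero proper subcomodules. -/
def IsSimpleComod (M : Comod k C) : Prop :=
  Nontrivial M.V ∧ ∀ W : Submodule k M.V, IsSubcomodule M.β W → W = ⊥ ∨ W = ⊤

/-- A comodule is indecomposable if it is nonzero and is not the direct sum of two
nonzero subcomodules. -/
def IsIndecomposableComod (M : Comod k C) : Prop :=
  Nontrivial M.V ∧ ∀ W W' : Submodule k M.V,
    IsSubcomodule M.β W → IsSubcomodule M.β W' → IsCompl W W' → W = ⊥ ∨ W' = ⊥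

/-- A comodule is injective if it splits off every comodule containing it as a
subcomodule. -/
def IsInjectiveComod (M : Comod k C) : Prop :=
  ∀ (W : Comod k C) (g : M.V →ₗ[k] W.V),
    IsComodHom M.β W.β g → Function.Injective g →
      ∃ X' : Submodule k W.V, IsSubcomodule W.β X' ∧ IsCompl (LinearMap.range g) X'

/-- `N` is an injective cover of the simple comodule `S`: `N` is indecomposable,
injective, and its socle is a copy of `S`. -/
def IsInjectiveCover (N S : Comod k C) : Prop :=
  IsIndecomposableComod N ∧ IsInjectiveComod N ∧
    ∃ g : S.V →ₗ[k] N.V, IsComodHom S.β N.β g ∧ Function.Injective g ∧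
      LinearMap.range g = socle N.β

/-- The coefficient map `φ_V : V* ⊗ V → C` of a comodule `(V, β)`, given by right linear
extension of forms, `φ_V (ω ⊗ v) = (ω ⊗ id) (β v)`. -/
noncomputable def coeffMap {V : Type} [AddCommGroup V] [Module k V]
    (β : V →ₗ[k] V ⊗[k] C) : (Module.Dual k V) ⊗[k] V →ₗ[k] C :=
  (TensorProduct.lid k C).toLinearMap ∘ₗ
    (contractLeft k V).rTensor C ∘ₗ
    (TensorProduct.assoc k (Module.Dual k V) V C).symm.toLinearMap ∘ₗ
    LinearMap.lTensor (Module.Dual k V) β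

variable {D : Type} [AddCommGroup D] [Module k D] [Coalgebra k D]

/-- `π : C → D` is a homomorphism of coalgebras: `Δ' ∘ π = (π ⊗ π) ∘ Δ` and
`ε' ∘ π = ε`. -/
structure IsCoalgebraHom (π : C →ₗ[k] D) : Prop where
  comul_comp : Coalgebra.comul (R := k) (A := D) ∘ₗ π =
    TensorProduct.map π π ∘ₗ Coalgebra.comul (R := k) (A := C)
  counit_comp : Coalgebra.counit (R := k) (A := D) ∘ₗ π =
    Coalgebra.counit (R := k) (A := C)

/-- The induced comodule `ind_D^C (V)` of a right `D`-comodule `(V, β)` along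
`π : C → D`:  `{ x ∈ V ⊗ C | (β ⊗ id)(x) = (id ⊗ (π ⊗ id) Δ)(x) }`. -/
noncomputable def inducedComod {V : Type} [AddCommGroup V] [Module k V]
    (π : C →ₗ[k] D) (β : V →ₗ[k] V ⊗[k] D) : Submodule k (V ⊗[k] C) :=
  LinearMap.ker
    ((TensorProduct.assoc k V D C).toLinearMap ∘ₗ β.rTensor C -
      LinearMap.lTensor V (π.rTensor C ∘ₗ Coalgebra.comul (R := k) (A := C)))

/-- The canonical map `(π ⊗ id) ∘ Δ : C → D ⊗ C`. -/
noncomputable def indUnit (π : C →ₗ[k] D) : C →ₗ[k] D ⊗[k] C :=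
  π.rTensor C ∘ₗ Coalgebra.comul (R := k) (A := C)

/-- The map `(ε' ⊗ id) : D ⊗ C → C` (followed by scalar multiplication). -/
noncomputable def counitContract : D ⊗[k] C →ₗ[k] C :=
  (TensorProduct.lid k C).toLinearMap ∘ₗ
    (Coalgebra.counit (R := k) (A := D)).rTensor C

/-- The ambient coaction `id_V ⊗ Δ` on `V ⊗ C` (of which the structure map of the
induced comodule is the restriction). -/
noncomputable def ambientCoaction (V : Type) [AddCommGroup V] [Module k V] :
    V ⊗[k] C →ₗ[k] (V ⊗[k] C) ⊗[k] C :=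
  (TensorProduct.assoc k V C C).symm.toLinearMap ∘ₗ
    LinearMap.lTensor V (Coalgebra.comul (R := k) (A := C))

open DirectSum

/-- The componentwise coaction on a direct sum of comodules. -/
noncomputable def dsCoaction {ι' : Type} (Vf : ι' → Type)
    [∀ i, AddCommGroup (Vf i)] [∀ i, Module k (Vf i)]
    (βf : ∀ i, Vf i →ₗ[k] Vf i ⊗[k] C) :
    (⨁ i, Vf i) →ₗ[k] (⨁ i, Vf i) ⊗[k] C :=
  letI := Classical.decEq ι'
  DirectSum.toModule k ι' ((⨁ i, Vf i) ⊗[k] C)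
    (fun i => LinearMap.rTensor C (DirectSum.lof k ι' Vf i) ∘ₗ βf i)

section Aux

variable {V W : Type} [AddCommGroup V] [Module k V] [AddCommGroup W] [Module k W]

lemma mem_ind (π : C →ₗ[k] D) (β : V →ₗ[k] V ⊗[k] D) (x : V ⊗[k] C) :
    x ∈ inducedComod π β ↔
      TensorProduct.assoc k V D C (β.rTensor C x) = LinearMap.lTensor V (indUnit π) x := by
  unfold inducedComod indUnit
  rw [LinearMap.mem_ker, LinearMap.sub_apply, sub_eq_zero]
  rfl

lemma amb_tmul (v : V) (c : C) : ambientCoaction (k := k) V (v ⊗ₜ[k] c) =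
    (TensorProduct.assoc k V C C).symm (v ⊗ₜ Coalgebra.comul (R := k) c) := rfl

lemma amb_mk (v : V) : ambientCoaction (k := k) (C := C) V ∘ₗ TensorProduct.mk k V C v =
    (TensorProduct.mk k V C v).rTensor C ∘ₗ Coalgebra.comul (R := k) := by
  ext c
  simp only [LinearMap.comp_apply, TensorProduct.mk_apply, amb_tmul]
  induction Coalgebra.comul (R := k) c using TensorProduct.induction_on with
  | zero => simp
  | tmul a b => simp
  | add a b ha hb => simp only [TensorProduct.tmul_add, map_add, ha, hb]

lemma assoc_rr (f : V →ₗ[k] W) (X Y : Type) [AddCommGroup X] [Module k X] [AddCommGroup Y]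
    [Module k Y] (s : (V ⊗[k] X) ⊗[k] Y) :
    TensorProduct.assoc k W X Y ((f.rTensor X).rTensor Y s) =
      f.rTensor (X ⊗[k] Y) (TensorProduct.assoc k V X Y s) := by
  have : (TensorProduct.assoc k W X Y).toLinearMap ∘ₗ ((f.rTensor X).rTensor Y) =
      f.rTensor (X ⊗[k] Y) ∘ₗ (TensorProduct.assoc k V X Y).toLinearMap := by
    ext; simp
  exact LinearMap.congr_fun this s

lemma rl_comm {X Y : Type} [AddCommGroup X] [Module k X] [AddCommGroup Y]
    [Module k Y] (f : V →ₗ[k] W) (g : X →ₗ[k] Y) (x : V ⊗[k] X) :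
    f.rTensor Y (LinearMap.lTensor V g x) = LinearMap.lTensor W g (f.rTensor X x) := by
  rw [← LinearMap.comp_apply, ← LinearMap.comp_apply, LinearMap.rTensor_comp_lTensor,
    LinearMap.lTensor_comp_rTensor]

lemma amb_natural (f : V →ₗ[k] W) (x : V ⊗[k] C) :
    (f.rTensor C).rTensor C (ambientCoaction V x) = ambientCoaction W (f.rTensor C x) := by
  apply (TensorProduct.assoc k W C C).injective
  rw [assoc_rr]
  simp only [ambientCoaction, LinearMap.comp_apply, LinearEquiv.coe_coe,
    LinearEquiv.apply_symm_apply]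
  rw [← LinearMap.comp_apply, ← LinearMap.comp_apply, LinearMap.rTensor_comp_lTensor,
    LinearMap.lTensor_comp_rTensor]

lemma amb_counit (x : V ⊗[k] C) :
    ((TensorProduct.rid k V).toLinearMap ∘ₗ
      LinearMap.lTensor V (Coalgebra.counit (R := k) (A := C))).rTensor C
        (ambientCoaction V x) = x := by
  induction x using TensorProduct.induction_on with
  | zero => simp
  | add a b ha hb => rw [map_add, map_add, ha, hb]
  | tmul v c =>
    rw [amb_tmul]
    have h : ∀ t : C ⊗[k] C, ((TensorProduct.rid k V).toLinearMap ∘ₗ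
      LinearMap.lTensor V (Coalgebra.counit (R := k) (A := C))).rTensor C
        ((TensorProduct.assoc k V C C).symm (v ⊗ₜ t)) =
        v ⊗ₜ (TensorProduct.lid k C ((Coalgebra.counit (R := k) (A := C)).rTensor C t)) := by
      intro t
      induction t using TensorProduct.induction_on with
      | zero => simp
      | tmul a b => simp [TensorProduct.smul_tmul]
      | add a b ha hb => simp only [TensorProduct.tmul_add, map_add, ha, hb]
    rw [h, Coalgebra.rTensor_counit_comul]
    simp

lemma amb_isComodule (V : Type) [AddCommGroup V] [Module k V] :
    IsComodule k C (ambientCoaction (k := k) (C := C) V) := by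
  constructor
  · apply TensorProduct.ext'
    intro v c
    have h1 : ambientCoaction (k := k) V (v ⊗ₜ[k] c) =
        (TensorProduct.mk k V C v).rTensor C (Coalgebra.comul (R := k) c) :=
      LinearMap.congr_fun (amb_mk v) c
    simp only [LinearMap.comp_apply, LinearEquiv.coe_coe]
    rw [h1, ← LinearMap.rTensor_comp_apply, amb_mk, LinearMap.rTensor_comp_apply, assoc_rr,
      Coalgebra.coassoc_apply, rl_comm]
  · apply TensorProduct.ext'
    intro v c
    have h1 : ambientCoaction (k := k) V (v ⊗ₜ[k] c) =
        (TensorProduct.mk k V C v).rTensor C (Coalgebra.comul (R := k) c) :=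
      LinearMap.congr_fun (amb_mk v) c
    simp only [LinearMap.comp_apply, LinearEquiv.coe_coe]
    rw [h1, ← LinearMap.comp_apply, LinearMap.lTensor_comp_rTensor,
      ← LinearMap.rTensor_comp_lTensor, LinearMap.comp_apply, Coalgebra.lTensor_counit_comul]
    simp

lemma indUnit_comul (π : C →ₗ[k] D) (c : C) :
    LinearMap.lTensor D (Coalgebra.comul (R := k)) (indUnit π c) =
      TensorProduct.assoc k D C C ((indUnit π).rTensor C (Coalgebra.comul (R := k) c)) := by
  unfold indUnit
  rw [LinearMap.rTensor_comp_apply, assoc_rr, Coalgebra.coassoc_apply, LinearMap.comp_apply, rl_comm]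

lemma indUnit_indUnit (π : C →ₗ[k] D) (hπ : IsCoalgebraHom π) (c : C) :
    TensorProduct.assoc k D D C ((Coalgebra.comul (R := k) (A := D)).rTensor C (indUnit π c)) =
      LinearMap.lTensor D (indUnit π) (indUnit π c) := by
  have h1 : LinearMap.lTensor D (indUnit π) (indUnit π c) =
      LinearMap.lTensor D (π.rTensor C) (LinearMap.lTensor D (Coalgebra.comul (R := k))
        (indUnit π c)) := by
    rw [← LinearMap.lTensor_comp_apply]; rfl
  rw [h1, indUnit_comul]
  have h2 : (Coalgebra.comul (R := k) (A := D)).rTensor C (indUnit π c) =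
      (LinearMap.lTensor D π).rTensor C ((indUnit π).rTensor C (Coalgebra.comul (R := k) c)) := by
    rw [← LinearMap.rTensor_comp_apply]
    unfold indUnit
    rw [LinearMap.comp_apply, ← LinearMap.rTensor_comp_apply, hπ.comul_comp,
      ← LinearMap.comp_assoc, LinearMap.lTensor_comp_rTensor]
  rw [h2]
  generalize (indUnit π).rTensor C (Coalgebra.comul (R := k) c) = s
  have : (TensorProduct.assoc k D D C).toLinearMap ∘ₗ (LinearMap.lTensor D π).rTensor C =
      LinearMap.lTensor D (π.rTensor C) ∘ₗ (TensorProduct.assoc k D C C).toLinearMap := by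
    ext; simp
  exact LinearMap.congr_fun this s

/-- The retraction of `V ⊗ C` onto the induced comodule. -/
noncomputable def indRetr (π : C →ₗ[k] D) (r : V ⊗[k] D →ₗ[k] V) : V ⊗[k] C →ₗ[k] V ⊗[k] C :=
  r.rTensor C ∘ₗ (TensorProduct.assoc k V D C).symm.toLinearMap ∘ₗ
    LinearMap.lTensor V (indUnit π)

lemma indRetr_mem (π : C →ₗ[k] D) (hπ : IsCoalgebraHom π) (β : V →ₗ[k] V ⊗[k] D)
    (r : V ⊗[k] D →ₗ[k] V) (hr : r.rTensor D ∘ₗ ambientCoaction V = β ∘ₗ r) (x : V ⊗[k] C) :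
    indRetr π r x ∈ inducedComod π β := by
  rw [mem_ind]
  induction x using TensorProduct.induction_on with
  | zero => simp
  | add a b ha hb => simp only [map_add, ha, hb]
  | tmul v c =>
    simp only [indRetr, LinearMap.comp_apply, LinearEquiv.coe_coe, LinearMap.lTensor_tmul]
    rw [← LinearMap.rTensor_comp_apply, ← hr, LinearMap.rTensor_comp_apply, assoc_rr]
    have h1 : ∀ u : D ⊗[k] C, LinearMap.lTensor V (indUnit π)
        (r.rTensor C ((TensorProduct.assoc k V D C).symm (v ⊗ₜ u))) =
        r.rTensor (D ⊗[k] C) ((TensorProduct.assoc k V D (D ⊗[k] C)).symm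
          (v ⊗ₜ LinearMap.lTensor D (indUnit π) u)) := by
      intro u
      induction u using TensorProduct.induction_on with
      | zero => simp
      | tmul a b => simp
      | add a b ha hb => simp only [TensorProduct.tmul_add, map_add, ha, hb]
    rw [h1, ← indUnit_indUnit π hπ]
    congr 1
    generalize indUnit π c = u
    induction u using TensorProduct.induction_on with
    | zero => simp
    | add a b ha hb => simp only [TensorProduct.tmul_add, map_add, ha, hb]
    | tmul d c =>
      simp only [TensorProduct.assoc_symm_tmul, LinearMap.rTensor_tmul, amb_tmul]
      induction Coalgebra.comul (R := k) d using TensorProduct.induction_on with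
      | zero => simp
      | tmul a b => simp
      | add a b ha hb =>
        simp only [TensorProduct.tmul_add, TensorProduct.add_tmul, map_add, ha, hb]

lemma indRetr_hom (π : C →ₗ[k] D) (r : V ⊗[k] D →ₗ[k] V) (x : V ⊗[k] C) :
    (indRetr π r).rTensor C (ambientCoaction V x) = ambientCoaction V (indRetr π r x) := by
  rw [indRetr, LinearMap.comp_apply, ← amb_natural, LinearMap.rTensor_comp_apply]
  congr 1
  induction x using TensorProduct.induction_on with
  | zero => simp
  | add a b ha hb => simp only [map_add, ha, hb]
  | tmul v c =>
    simp only [LinearMap.comp_apply, LinearEquiv.coe_coe, LinearMap.lTensor_tmul, amb_tmul]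
    have h1 : ∀ u : D ⊗[k] C, ambientCoaction (k := k) (V ⊗[k] D)
        ((TensorProduct.assoc k V D C).symm (v ⊗ₜ u)) =
        (TensorProduct.assoc k (V ⊗[k] D) C C).symm
        ((TensorProduct.assoc k V D (C ⊗[k] C)).symm
          (v ⊗ₜ LinearMap.lTensor D (Coalgebra.comul (R := k)) u)) := by
      intro u
      induction u using TensorProduct.induction_on with
      | zero => simp
      | tmul a b => simp [amb_tmul]
      | add a b ha hb => simp only [TensorProduct.tmul_add, map_add, ha, hb]
    rw [h1, indUnit_comul]
    generalize Coalgebra.comul (R := k) c = t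
    induction t using TensorProduct.induction_on with
    | zero => simp
    | add a b ha hb => simp only [TensorProduct.tmul_add, map_add, ha, hb]
    | tmul a b =>
      simp only [TensorProduct.assoc_symm_tmul, LinearMap.rTensor_tmul, LinearMap.comp_apply,
        LinearEquiv.coe_coe, LinearMap.lTensor_tmul]
      generalize indUnit π a = u
      induction u using TensorProduct.induction_on with
      | zero => simp
      | tmul a b => simp
      | add a b ha hb =>
        simp only [TensorProduct.tmul_add, TensorProduct.add_tmul, map_add, ha, hb]

lemma indRetr_id (π : C →ₗ[k] D) (β : V →ₗ[k] V ⊗[k] D)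
    (r : V ⊗[k] D →ₗ[k] V) (hr : r ∘ₗ β = LinearMap.id) (x : V ⊗[k] C)
    (hx : x ∈ inducedComod π β) : indRetr π r x = x := by
  rw [mem_ind] at hx
  simp only [indRetr, LinearMap.comp_apply, LinearEquiv.coe_coe]
  rw [← hx, LinearEquiv.symm_apply_apply, ← LinearMap.rTensor_comp_apply, hr]
  simp

lemma ker_subcomod (β : V →ₗ[k] V ⊗[k] C) (γ : W →ₗ[k] W ⊗[k] C) (f : V →ₗ[k] W)
    (h : IsComodHom β γ f) : IsSubcomodule β (LinearMap.ker f) := by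
  intro w hw
  have hex := Module.Flat.rTensor_exact (R := k) C (LinearMap.exact_subtype_ker_map f)
  have := (hex (β w)).1 (by
    rw [← LinearMap.comp_apply, h, LinearMap.comp_apply, LinearMap.mem_ker.1 hw, map_zero])
  exact this

lemma exists_retr (β : V →ₗ[k] V ⊗[k] D) (hβ : IsComodule k D β)
    (hinj : ∀ (W : Comod k D) (g : V →ₗ[k] W.V), IsComodHom β W.β g →
        Function.Injective g →
        ∃ X' : Submodule k W.V, IsSubcomodule W.β X' ∧
          IsCompl (LinearMap.range g) X') :
    ∃ r : V ⊗[k] D →ₗ[k] V, r ∘ₗ β = LinearMap.id ∧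
      r.rTensor D ∘ₗ ambientCoaction V = β ∘ₗ r := by
  have hbinj : Function.Injective β := by
    intro a b hab
    have ha := LinearMap.congr_fun hβ.counit_id a
    have hb := LinearMap.congr_fun hβ.counit_id b
    simp only [LinearMap.comp_apply, LinearMap.id_apply] at ha hb
    rw [← ha, ← hb, hab]
  have hhom : ∀ v, β.rTensor D (β v) = ambientCoaction V (β v) := by
    intro v
    apply (TensorProduct.assoc k V D D).injective
    have := LinearMap.congr_fun hβ.coassoc v
    simp only [ambientCoaction, LinearMap.comp_apply, LinearEquiv.coe_coe,
      LinearEquiv.apply_symm_apply] at this ⊢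
    exact this
  obtain ⟨X, hX, hc⟩ := hinj ⟨V ⊗[k] D, ambientCoaction V, amb_isComodule V⟩ β
    (LinearMap.ext hhom) hbinj
  change Submodule k (V ⊗[k] D) at X
  change IsSubcomodule (ambientCoaction V) X at hX
  let r : V ⊗[k] D →ₗ[k] V := LinearMap.ofIsCompl hc
    (LinearEquiv.ofInjective β hbinj).symm.toLinearMap 0
  have hr1 : ∀ v, r (β v) = v := by
    intro v
    have := LinearMap.ofIsCompl_apply_left hc
      (φ := (LinearEquiv.ofInjective β hbinj).symm.toLinearMap) (ψ := 0)
      (LinearEquiv.ofInjective β hbinj v)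
    simpa using this
  have hr2 : ∀ x ∈ X, r x = 0 := fun x hx =>
    LinearMap.ofIsCompl_apply_right hc
      (φ := (LinearEquiv.ofInjective β hbinj).symm.toLinearMap) (ψ := 0) ⟨x, hx⟩
  have hrb : r ∘ₗ β = LinearMap.id := LinearMap.ext hr1
  refine ⟨r, hrb, ?_⟩
  ext1
  apply LinearMap.ext₂ 
  intro v d
  change r.rTensor D (ambientCoaction V (v ⊗ₜ d)) = β (r (v ⊗ₜ d))
  generalize v ⊗ₜ[k] d = y
  have hy : y ∈ LinearMap.range β ⊔ X := by rw [hc.sup_eq_top]; trivial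
  obtain ⟨_, ⟨w, rfl⟩, x, hx, rfl⟩ := Submodule.mem_sup.1 hy
  obtain ⟨z, hz⟩ := hX x hx
  have h0 : r ∘ₗ X.subtype = 0 := LinearMap.ext fun x => hr2 x x.2
  rw [map_add, map_add, ← hz, ← LinearMap.rTensor_comp_apply, h0, ← hhom,
    ← LinearMap.rTensor_comp_apply, hrb, map_add, hr1, hr2 x hx]
  simp

lemma ind_isComodule (P : Submodule k (V ⊗[k] C)) (γ : P →ₗ[k] P ⊗[k] C)
    (hγ : P.subtype.rTensor C ∘ₗ γ = ambientCoaction (C := C) V ∘ₗ P.subtype) :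
    IsComodule k C γ := by
  have hA := amb_isComodule (k := k) (C := C) V
  have hγ' : ∀ x, P.subtype.rTensor C (γ x) = ambientCoaction (C := C) V x :=
    fun x => LinearMap.congr_fun hγ x
  constructor
  · ext1 x
    apply Module.Flat.rTensor_preserves_injective_linearMap (M := C ⊗[k] C) P.subtype
      P.injective_subtype
    have h1 := LinearMap.congr_fun hA.coassoc x
    simp only [LinearMap.comp_apply, LinearEquiv.coe_coe] at h1 ⊢
    rw [← assoc_rr, ← LinearMap.rTensor_comp_apply, hγ, LinearMap.rTensor_comp_apply, hγ', h1,
      ← hγ', rl_comm]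
  · ext1 x
    apply P.injective_subtype
    have h1 := LinearMap.congr_fun hA.counit_id x
    simp only [LinearMap.comp_apply, LinearEquiv.coe_coe, LinearMap.id_apply] at h1 ⊢
    have h2 : ∀ y : P ⊗[k] k, P.subtype (TensorProduct.rid k P y) =
        TensorProduct.rid k (V ⊗[k] C) (P.subtype.rTensor k y) := by
      intro y
      have : P.subtype ∘ₗ (TensorProduct.rid k P).toLinearMap =
          (TensorProduct.rid k (V ⊗[k] C)).toLinearMap ∘ₗ P.subtype.rTensor k := by
        ext; simp
      exact LinearMap.congr_fun this y
    rw [h2, ← LinearMap.comp_apply, LinearMap.rTensor_comp_lTensor,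
      ← LinearMap.lTensor_comp_rTensor, LinearMap.comp_apply, hγ', h1]
    rfl

lemma part_one (π : C →ₗ[k] D) (hπ : IsCoalgebraHom π)
    (β : V →ₗ[k] V ⊗[k] D) (hβ : IsComodule k D β)
    (hinj : ∀ (W : Comod k D) (g : V →ₗ[k] W.V), IsComodHom β W.β g →
        Function.Injective g →
        ∃ X' : Submodule k W.V, IsSubcomodule W.β X' ∧
          IsCompl (LinearMap.range g) X')
    (γ : ↥(inducedComod π β) →ₗ[k] ↥(inducedComod π β) ⊗[k] C)
    (hγ : (inducedComod π β).subtype.rTensor C ∘ₗ γ =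
          ambientCoaction (C := C) V ∘ₗ (inducedComod π β).subtype)
    (W : Comod k C) (g : ↥(inducedComod π β) →ₗ[k] W.V)
    (hg : IsComodHom γ W.β g) (hgi : Function.Injective g) :
    ∃ X' : Submodule k W.V, IsSubcomodule W.β X' ∧ IsCompl (LinearMap.range g) X' := by
  obtain ⟨r, hr1, hr2⟩ := exists_retr β hβ hinj
  obtain ⟨s, hs⟩ := LinearMap.exists_leftInverse_of_injective g (LinearMap.ker_eq_bot.2 hgi)
  let q : W.V →ₗ[k] V := ((TensorProduct.rid k V).toLinearMap ∘ₗ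
      LinearMap.lTensor V (Coalgebra.counit (R := k) (A := C))) ∘ₗ
      (inducedComod π β).subtype ∘ₗ s
  let h : W.V →ₗ[k] V ⊗[k] C := q.rTensor C ∘ₗ W.β
  have hh : ∀ w, h.rTensor C (W.β w) = ambientCoaction V (h w) := by
    intro w
    apply (TensorProduct.assoc k V C C).injective
    have h1 := LinearMap.congr_fun W.isComodule.coassoc w
    simp only [LinearMap.comp_apply, LinearEquiv.coe_coe] at h1
    simp only [h, LinearMap.rTensor_comp_apply]
    rw [assoc_rr, h1, rl_comm]
    simp [ambientCoaction]
  have hhg : ∀ x, h (g x) = x := by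
    intro x
    have h1 := LinearMap.congr_fun hg x
    simp only [LinearMap.comp_apply] at h1
    have h2 : q ∘ₗ g = ((TensorProduct.rid k V).toLinearMap ∘ₗ
      LinearMap.lTensor V (Coalgebra.counit (R := k) (A := C))) ∘ₗ
      (inducedComod π β).subtype := by
      simp only [q, LinearMap.comp_assoc, hs, LinearMap.comp_id]
    simp only [h, LinearMap.comp_apply]
    rw [← h1, ← LinearMap.rTensor_comp_apply, h2, LinearMap.rTensor_comp_apply]
    have h3 := LinearMap.congr_fun hγ x
    simp only [LinearMap.comp_apply] at h3
    rw [h3, amb_counit]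
    rfl
  let F := indRetr π r ∘ₗ h
  have hF : IsComodHom W.β (ambientCoaction V) F := by
    ext1 w
    simp only [F, LinearMap.comp_apply, LinearMap.rTensor_comp_apply]
    rw [hh, indRetr_hom]
  have hFg : ∀ x, F (g x) = x := by
    intro x
    simp only [F, LinearMap.comp_apply, hhg]
    exact indRetr_id π β r hr1 _ x.2
  refine ⟨LinearMap.ker F, ker_subcomod _ _ F hF, ?_⟩
  rw [isCompl_iff]
  constructor
  · rw [Submodule.disjoint_def]
    rintro _ ⟨x, rfl⟩ hx
    rw [LinearMap.mem_ker, hFg] at hx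
    rw [Subtype.ext (a1 := x) (a2 := 0) hx, map_zero]
  · rw [codisjoint_iff, eq_top_iff]
    intro w _
    let x : inducedComod π β := ⟨F w, indRetr_mem π hπ β r hr2 _⟩
    refine Submodule.mem_sup.2 ⟨g x, ⟨x, rfl⟩, w - g x, ?_, by abel⟩
    rw [LinearMap.mem_ker, map_sub, hFg, sub_self]

lemma ind_map (π : C →ₗ[k] D) (β : V →ₗ[k] V ⊗[k] D) (γ : W →ₗ[k] W ⊗[k] D)
    (f : V →ₗ[k] W) (hf : IsComodHom β γ f) (x : V ⊗[k] C) (hx : x ∈ inducedComod π β) :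
    f.rTensor C x ∈ inducedComod π γ := by
  rw [mem_ind] at hx ⊢
  rw [← LinearMap.rTensor_comp_apply, ← hf, LinearMap.rTensor_comp_apply, assoc_rr, hx,
    ← LinearMap.comp_apply, ← LinearMap.comp_apply,
      LinearMap.rTensor_comp_lTensor, LinearMap.lTensor_comp_rTensor]

lemma contract_indUnit (π : C →ₗ[k] D) (hπ : IsCoalgebraHom π) (c : C) :
    counitContract (k := k) (indUnit π c) = c := by
  simp only [counitContract, indUnit, LinearMap.comp_apply, LinearEquiv.coe_coe]
  rw [← LinearMap.rTensor_comp_apply, hπ.counit_comp, Coalgebra.rTensor_counit_comul]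
  simp

lemma indUnit_contract (π : C →ₗ[k] D) (y : D ⊗[k] C)
    (hy : y ∈ inducedComod π (Coalgebra.comul (R := k) (A := D))) :
    indUnit π (counitContract y) = y := by
  rw [mem_ind] at hy
  have h1 : indUnit π (counitContract y) = TensorProduct.lid k _
      ((Coalgebra.counit (R := k) (A := D)).rTensor (D ⊗[k] C)
        (LinearMap.lTensor D (indUnit π) y)) := by
    clear hy
    induction y using TensorProduct.induction_on with
    | zero => simp
    | add a b ha hb => simp only [map_add, ha, hb]
    | tmul d c => simp [counitContract]
  rw [h1, ← hy, ← assoc_rr, ← LinearMap.rTensor_comp_apply,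
    Coalgebra.rTensor_counit_comp_comul]
  clear hy h1
  induction y using TensorProduct.induction_on with
  | zero => simp
  | add a b ha hb => simp only [map_add, ha, hb]
  | tmul d c => simp

lemma contract_hom (y : D ⊗[k] C) :
    (counitContract (k := k) (C := C) (D := D)).rTensor C (ambientCoaction D y) =
      Coalgebra.comul (R := k) (counitContract (k := k) y) := by
  induction y using TensorProduct.induction_on with
  | zero => simp
  | add a b ha hb => simp only [map_add, ha, hb]
  | tmul d c =>
    rw [amb_tmul]
    simp only [counitContract, LinearMap.comp_apply, LinearMap.rTensor_tmul, LinearEquiv.coe_coe,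
      TensorProduct.lid_tmul, map_smul]
    induction Coalgebra.comul (R := k) c using TensorProduct.induction_on with
    | zero => simp
    | tmul a b => simp [TensorProduct.smul_tmul']
    | add a b ha hb => simp only [TensorProduct.tmul_add, map_add, ha, hb, smul_add]


open DirectSum

lemma part_two (π : C →ₗ[k] D) (hπ : IsCoalgebraHom π) (J : Type) (I : J → Comod k D)
    (e : D ≃ₗ[k] ⨁ p : J, (I p).V)
    (he : IsComodHom (Coalgebra.comul (R := k) (A := D))
          (dsCoaction (fun p => (I p).V) (fun p => (I p).β)) e.toLinearMap)
    (γ : ∀ p : J, ↥(inducedComod π (I p).β) →ₗ[k] ↥(inducedComod π (I p).β) ⊗[k] C)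
    (hγ : ∀ p, (inducedComod π (I p).β).subtype.rTensor C ∘ₗ γ p =
          ambientCoaction (C := C) ((I p).V) ∘ₗ (inducedComod π (I p).β).subtype) :
    ∃ ec : C ≃ₗ[k] ⨁ p : J, ↥(inducedComod π (I p).β),
      IsComodHom (Coalgebra.comul (R := k) (A := C))
        (dsCoaction (fun p => ↥(inducedComod π (I p).β)) γ) ec.toLinearMap := by
  letI : DecidableEq J := Classical.decEq J
  let a : ∀ p, (I p).V →ₗ[k] D := fun p =>
    e.symm.toLinearMap ∘ₗ DirectSum.lof k J (fun p => (I p).V) p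
  let b : ∀ p, D →ₗ[k] (I p).V := fun p =>
    DirectSum.component k J (fun p => (I p).V) p ∘ₗ e.toLinearMap
  have hds : ∀ p, dsCoaction (fun p => (I p).V) (fun p => (I p).β) ∘ₗ
      DirectSum.lof k J (fun p => (I p).V) p =
      (DirectSum.lof k J (fun p => (I p).V) p).rTensor D ∘ₗ (I p).β := by
    intro p
    ext1 x
    exact DirectSum.toModule_lof k (M := fun p => (I p).V) p x
  have ha : ∀ p, IsComodHom (I p).β (Coalgebra.comul (R := k) (A := D)) (a p) := by
    intro p
    unfold IsComodHom
    have h1 : (e.symm.toLinearMap).rTensor D ∘ₗ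
        dsCoaction (fun p => (I p).V) (fun p => (I p).β) =
        Coalgebra.comul (R := k) (A := D) ∘ₗ e.symm.toLinearMap := by
      refine LinearMap.ext fun y => ?_
      have h2 := LinearMap.congr_fun he (e.symm y)
      simp only [LinearMap.comp_apply, LinearEquiv.coe_coe, LinearEquiv.apply_symm_apply] at h2 ⊢
      rw [← h2, ← LinearMap.rTensor_comp_apply]
      simp
    simp only [a]
    rw [LinearMap.rTensor_comp, LinearMap.comp_assoc, ← hds, ← LinearMap.comp_assoc, h1,
      LinearMap.comp_assoc]
  have hb : ∀ p, IsComodHom (Coalgebra.comul (R := k) (A := D)) (I p).β (b p) := by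
    intro p
    unfold IsComodHom
    have h1 : (DirectSum.component k J (fun p => (I p).V) p).rTensor D ∘ₗ
        dsCoaction (fun p => (I p).V) (fun p => (I p).β) =
        (I p).β ∘ₗ DirectSum.component k J (fun p => (I p).V) p := by
      apply DirectSum.linearMap_ext
      intro q
      rw [LinearMap.comp_assoc, hds, ← LinearMap.comp_assoc, ← LinearMap.rTensor_comp,
        LinearMap.comp_assoc]
      by_cases hq : q = p
      · subst hq
        have : DirectSum.component k J (fun p => (I p).V) q ∘ₗ
          DirectSum.lof k J (fun p => (I p).V) q = LinearMap.id := by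
          ext1 x; exact DirectSum.component.lof_self k (M := fun p => (I p).V) q x
        rw [this]; simp
      · have : DirectSum.component k J (fun p => (I p).V) p ∘ₗ
          DirectSum.lof k J (fun p => (I p).V) q = 0 := by
          ext1 x
          have := DirectSum.component.of k (M := fun p => (I p).V) p q x
          rw [dif_neg hq] at this
          exact this
        rw [this]; simp
    simp only [b]
    rw [LinearMap.rTensor_comp, LinearMap.comp_assoc, he, ← LinearMap.comp_assoc, h1,
      LinearMap.comp_assoc]
  have hba : ∀ p, b p ∘ₗ a p = LinearMap.id := by
    intro p
    ext1 x
    simp only [a, b, LinearMap.comp_apply, LinearEquiv.coe_coe, LinearEquiv.apply_symm_apply]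
    exact DirectSum.component.lof_self k (M := fun p => (I p).V) p x
  have hba' : ∀ p q, q ≠ p → b p ∘ₗ a q = 0 := by
    intro p q hq
    ext1 x
    simp only [a, b, LinearMap.comp_apply, LinearEquiv.coe_coe, LinearEquiv.apply_symm_apply]
    have := DirectSum.component.of k (M := fun p => (I p).V) p q x
    rw [dif_neg hq] at this
    exact this
  have hsum : ∀ d : D, ∃ s : Finset J, ∀ t, s ⊆ t → ∑ p ∈ t, a p (b p d) = d := by
    intro d
    classical
    refine ⟨DFinsupp.support (e d), fun t ht => ?_⟩
    apply e.injective
    rw [map_sum]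
    simp only [a, b, LinearMap.comp_apply, LinearEquiv.coe_coe, LinearEquiv.apply_symm_apply]
    generalize e d = y at ht ⊢
    have h1 := DirectSum.sum_support_of y
    have h2 := Finset.sum_subset ht
      (f := fun i => DirectSum.of (fun p => (I p).V) i (y i)) (fun i _ hi => by
        rw [DFinsupp.notMem_support_iff.1 hi, map_zero])
    exact h2.symm.trans h1
  have hsum2 : ∀ y : D ⊗[k] C, ∃ s : Finset J, ∀ t, s ⊆ t →
      ∑ p ∈ t, (a p).rTensor C ((b p).rTensor C y) = y := by
    intro y
    induction y using TensorProduct.induction_on with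
    | zero => exact ⟨∅, by simp⟩
    | tmul d c =>
      obtain ⟨s, hs⟩ := hsum d
      refine ⟨s, fun t ht => ?_⟩
      simp only [LinearMap.rTensor_tmul]
      rw [← TensorProduct.sum_tmul, hs t ht]
    | add x y hx hy =>
      obtain ⟨s, hs⟩ := hx
      obtain ⟨s', hs'⟩ := hy
      refine ⟨s ∪ s', fun t ht => ?_⟩
      simp only [map_add, Finset.sum_add_distrib]
      rw [hs t (Finset.union_subset_left ht), hs' t (Finset.union_subset_right ht)]
  let Fp : ∀ p, ↥(inducedComod π (I p).β) →ₗ[k] C := fun p =>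
    counitContract ∘ₗ (a p).rTensor C ∘ₗ (inducedComod π (I p).β).subtype
  let F : (⨁ p : J, ↥(inducedComod π (I p).β)) →ₗ[k] C := DirectSum.toModule k J C Fp
  have hFlof : ∀ p x, F (DirectSum.lof k J (fun p => ↥(inducedComod π (I p).β)) p x) = Fp p x :=
    fun p x => DirectSum.toModule_lof k (M := fun p => ↥(inducedComod π (I p).β)) p x
  have hU : ∀ p x, indUnit π (Fp p x) = (a p).rTensor C (x : (I p).V ⊗[k] C) := by
    intro p x
    exact indUnit_contract π _ (ind_map π _ _ (a p) (ha p) _ x.2)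
  have hproj : ∀ p x, (b p).rTensor C (indUnit π (F x)) = (x p : (I p).V ⊗[k] C) := by
    intro p x
    have : (b p).rTensor C ∘ₗ indUnit π ∘ₗ F = (inducedComod π (I p).β).subtype ∘ₗ
        DirectSum.component k J (fun p => ↥(inducedComod π (I p).β)) p := by
      apply DirectSum.linearMap_ext
      intro q
      ext1 x
      simp only [LinearMap.comp_apply, hFlof, hU]
      rw [← LinearMap.rTensor_comp_apply]
      by_cases hq : q = p
      · subst hq
        rw [hba, DirectSum.component.lof_self]
        simp
      · rw [hba' p q hq, DirectSum.component.of, dif_neg hq]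
        simp
    exact LinearMap.congr_fun this x
  have hinj : Function.Injective F := by
    intro x y hxy
    apply DFinsupp.ext
    intro p
    apply Subtype.ext
    rw [← hproj, ← hproj, hxy]
  have hsurj : Function.Surjective F := by
    intro c
    obtain ⟨s, hs⟩ := hsum2 (indUnit π c)
    have hc : indUnit π c ∈ inducedComod π (Coalgebra.comul (R := k) (A := D)) := by
      rw [mem_ind]; exact indUnit_indUnit π hπ c
    refine ⟨∑ p ∈ s, DirectSum.lof k J (fun p => ↥(inducedComod π (I p).β)) p
      ⟨(b p).rTensor C (indUnit π c), ind_map π _ _ (b p) (hb p) _ hc⟩, ?_⟩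
    rw [map_sum]
    simp only [hFlof, Fp, LinearMap.comp_apply, Submodule.subtype_apply]
    rw [← map_sum, hs s (Finset.Subset.refl s), contract_indUnit π hπ]
  have hFhom : ∀ x, F.rTensor C (dsCoaction (fun p => ↥(inducedComod π (I p).β)) γ x) =
      Coalgebra.comul (R := k) (F x) := by
    intro x
    have : F.rTensor C ∘ₗ dsCoaction (fun p => ↥(inducedComod π (I p).β)) γ =
        Coalgebra.comul (R := k) ∘ₗ F := by
      apply DirectSum.linearMap_ext
      intro p
      ext1 x
      have h1 : dsCoaction (fun p => ↥(inducedComod π (I p).β)) γ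
          (DirectSum.lof k J (fun p => ↥(inducedComod π (I p).β)) p x) =
          (DirectSum.lof k J (fun p => ↥(inducedComod π (I p).β)) p).rTensor C (γ p x) :=
        DirectSum.toModule_lof k (M := fun p => ↥(inducedComod π (I p).β)) p x
      have h2 : F ∘ₗ DirectSum.lof k J (fun p => ↥(inducedComod π (I p).β)) p = Fp p :=
        LinearMap.ext (hFlof p)
      have h3 := LinearMap.congr_fun (hγ p) x
      simp only [LinearMap.comp_apply] at h3 ⊢
      rw [h1, ← LinearMap.rTensor_comp_apply, h2, hFlof]
      simp only [Fp, LinearMap.rTensor_comp_apply, LinearMap.comp_apply]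
      rw [h3, amb_natural, contract_hom]
    exact LinearMap.congr_fun this x
  let E := LinearEquiv.ofBijective F ⟨hinj, hsurj⟩
  refine ⟨E.symm, ?_⟩
  ext1 c
  obtain ⟨x, rfl⟩ := hsurj c
  have hE : E.symm.toLinearMap ∘ₗ F = LinearMap.id := by
    refine LinearMap.ext fun x => ?_
    exact E.symm_apply_apply x
  have hE' : E.symm (F x) = x := E.symm_apply_apply x
  simp only [LinearMap.comp_apply, LinearEquiv.coe_coe]
  rw [hE', ← hFhom, ← LinearMap.rTensor_comp_apply, hE]
  simp

end Aux

/-- For a surjective coalgebra homomorphism `π : C → D`, induction carries injective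
`D`-comodules to injective `C`-comodules; in particular any decomposition
`D ≅ ⊕_ν m_ν I_ν` into indecomposable injective `D`-comodules yields a decomposition
`C ≅ ⊕_ν m_ν ind_D^C (I_ν)` of `C` into injective `C`-comodules.  (The structure map of
an induced comodule is the restriction of `id ⊗ Δ`; below it appears as any coaction
`γ` compatible with `id ⊗ Δ`.) -/
theorem induction_preserves_injectives
    (π : C →ₗ[k] D) (hπ : IsCoalgebraHom π) (hsurj : Function.Surjective π) :
    (∀ (V : Type) (_ : AddCommGroup V) (_ : Module k V)
      (β : V →ₗ[k] V ⊗[k] D), IsComodule k D β →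
      (∀ (W : Comod k D) (g : V →ₗ[k] W.V), IsComodHom β W.β g →
        Function.Injective g →
        ∃ X' : Submodule k W.V, IsSubcomodule W.β X' ∧
          IsCompl (LinearMap.range g) X') →
      ∀ γ : ↥(inducedComod π β) →ₗ[k] ↥(inducedComod π β) ⊗[k] C,
        ((inducedComod π β).subtype.rTensor C ∘ₗ γ =
          ambientCoaction (C := C) V ∘ₗ (inducedComod π β).subtype) →
        IsComodule k C γ ∧
        ∀ (W : Comod k C) (g : ↥(inducedComod π β) →ₗ[k] W.V),
          IsComodHom γ W.β g → Function.Injective g →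
          ∃ X' : Submodule k W.V, IsSubcomodule W.β X' ∧
            IsCompl (LinearMap.range g) X') ∧
    (∀ (ι : Type) (μ : ι → Type) (I : ι → Comod k D),
      (∀ ν, IsIndecomposableComod (I ν)) → (∀ ν, IsInjectiveComod (I ν)) →
      ∀ e : D ≃ₗ[k] ⨁ p : Σ ν : ι, μ ν, (I p.1).V,
        IsComodHom (Coalgebra.comul (R := k) (A := D))
          (dsCoaction (ι' := Σ ν : ι, μ ν) (fun p => (I p.1).V) (fun p => (I p.1).β))
          e.toLinearMap →
      ∀ γ : ∀ p : Σ ν : ι, μ ν,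
          ↥(inducedComod π (I p.1).β) →ₗ[k] ↥(inducedComod π (I p.1).β) ⊗[k] C,
        (∀ p, (inducedComod π (I p.1).β).subtype.rTensor C ∘ₗ γ p =
          ambientCoaction (C := C) ((I p.1).V) ∘ₗ (inducedComod π (I p.1).β).subtype) →
        ∃ ec : C ≃ₗ[k] ⨁ p : Σ ν : ι, μ ν, ↥(inducedComod π (I p.1).β),
          IsComodHom (Coalgebra.comul (R := k) (A := C))
            (dsCoaction (ι' := Σ ν : ι, μ ν)
              (fun p => ↥(inducedComod π (I p.1).β)) γ)
            ec.toLinearMap) := by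
  refine ⟨?_, ?_⟩
  · intro V _ _ β hβ hinj γ hγ
    exact ⟨ind_isComodule _ γ hγ, part_one π hπ β hβ hinj γ hγ⟩
  · intro ι μ I _ _ e he γ hγ
    exact part_two π hπ (Σ ν : ι, μ ν) (fun p => I p.1) e he γ hγ

end SuperCoalg
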